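/- arXiv:1809.01595 — 2 statements merged into one kernel-verified Lean document; each statement's English description precedes it below -/
import Mathlib

section
/- For every l ∈ ℕ, the mixed derivative of P_l ∘ h along V in the x-variables and V^⊥ in the y-variables vanishes on the diagonal: V_x V_y^⊥ P_l(h)|_{x=y} = 0. -/
open Real

/-- The degree-`l` Legendre polynomial, via the Rodrigues formula
`P_l(t) = 1/(2^l l!) dˡ/dtˡ (t² − 1)ˡ`. -/
noncomputable def legP (l : ℕ) : ℝ → ℝ :=
  fun t => (1 / (2 ^ l * (Nat.factorial l : ℝ))) * iteratedDeriv l (fun s => (s ^ 2 - 1) ^ l) t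

/-- `h(θ_x, φ_x, θ_y, φ_y)`, the cosine of the spherical distance. -/
noncomputable def sphH (θx φx θy φy : ℝ) : ℝ :=
  Real.cos φx * Real.cos φy + Real.sin φx * Real.sin φy * Real.cos (θx - θy)

/-- Functions of the four variables `(θ_x, φ_x, θ_y, φ_y)`. -/
abbrev F4 : Type := ℝ → ℝ → ℝ → ℝ → ℝ

/-- `∂/∂θ_x`. -/
noncomputable def pθx (f : F4) : F4 := fun a b c d => deriv (fun t => f t b c d) a
/-- `∂/∂φ_x`. -/
noncomputable def pφx (f : F4) : F4 := fun a b c d => deriv (fun t => f a t c d) b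
/-- `∂/∂θ_y`. -/
noncomputable def pθy (f : F4) : F4 := fun a b c d => deriv (fun t => f a b t d) c
/-- `∂/∂φ_y`. -/
noncomputable def pφy (f : F4) : F4 := fun a b c d => deriv (fun t => f a b c t) d

/-- The operator `V_x = v₁(θ_x,φ_x) ∂/∂θ_x + v₂(θ_x,φ_x) ∂/∂φ_x`. -/
noncomputable def Vx (v₁ v₂ : ℝ → ℝ → ℝ) (f : F4) : F4 :=
  fun a b c d => v₁ a b * pθx f a b c d + v₂ a b * pφx f a b c d

/-- The operator `V_y = v₁(θ_y,φ_y) ∂/∂θ_y + v₂(θ_y,φ_y) ∂/∂φ_y`. -/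
noncomputable def Vy (v₁ v₂ : ℝ → ℝ → ℝ) (f : F4) : F4 :=
  fun a b c d => v₁ c d * pθy f a b c d + v₂ c d * pφy f a b c d

/-- The operator `V_x^⊥ = v₂(θ_x,φ_x) ∂/∂θ_x − sin²(φ_x) v₁(θ_x,φ_x) ∂/∂φ_x`. -/
noncomputable def Vxp (v₁ v₂ : ℝ → ℝ → ℝ) (f : F4) : F4 :=
  fun a b c d => v₂ a b * pθx f a b c d - (Real.sin b) ^ 2 * v₁ a b * pφx f a b c d

/-- The operator `V_y^⊥ = v₂(θ_y,φ_y) ∂/∂θ_y − sin²(φ_y) v₁(θ_y,φ_y) ∂/∂φ_y`. -/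
noncomputable def Vyp (v₁ v₂ : ℝ → ℝ → ℝ) (f : F4) : F4 :=
  fun a b c d => v₂ c d * pθy f a b c d - (Real.sin d) ^ 2 * v₁ c d * pφy f a b c d

/-- `P_l ∘ h` as a function of the four variables. -/
noncomputable def PH (l : ℕ) : F4 := fun a b c d => legP l (sphH a b c d)

lemma contDiff_legP (l : ℕ) : ContDiff ℝ (⊤ : ℕ∞) (legP l) := by
  have hpow : ContDiff ℝ (⊤ : ℕ∞) (fun s : ℝ => (s ^ 2 - 1) ^ l) := by fun_prop
  unfold legP
  rw [iteratedDeriv_eq_iterate]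
  exact contDiff_const.mul (hpow.iterate_deriv l)

lemma hasDerivAt_sphH_θx (a b c d : ℝ) :
    HasDerivAt (fun t => sphH t b c d) (-(sin b * sin d * sin (a - c))) a := by
  have h := ((((hasDerivAt_id a).sub_const c).cos).const_mul (sin b * sin d)).const_add
    (cos b * cos d)
  exact h.congr_deriv (by simp)

lemma hasDerivAt_sphH_φx (a b c d : ℝ) :
    HasDerivAt (fun t => sphH a t c d) (-(sin b * cos d) + cos b * sin d * cos (a - c)) b := by
  have h := ((hasDerivAt_cos b).mul_const (cos d)).add
    (((hasDerivAt_sin b).mul_const (sin d)).mul_const (cos (a - c)))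
  exact h.congr_deriv (by ring)

lemma hasDerivAt_sphH_θy (a b c d : ℝ) :
    HasDerivAt (fun t => sphH a b t d) (sin b * sin d * sin (a - c)) c := by
  have h := ((((hasDerivAt_id c).const_sub a).cos).const_mul (sin b * sin d)).const_add
    (cos b * cos d)
  exact h.congr_deriv (by simp)

lemma hasDerivAt_sphH_φy (a b c d : ℝ) :
    HasDerivAt (fun t => sphH a b c t) (-(cos b * sin d) + sin b * cos d * cos (a - c)) d := by
  have h := ((hasDerivAt_cos d).const_mul (cos b)).add
    (((hasDerivAt_sin d).const_mul (sin b)).mul_const (cos (a - c)))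
  exact h.congr_deriv (by ring)

/-- The chain rule for `V_y^⊥`. -/
lemma Vyp_comp_sphH {f : ℝ → ℝ} (hf : Differentiable ℝ f) (v₁ v₂ : ℝ → ℝ → ℝ) (a b c d : ℝ) :
    Vyp v₁ v₂ (fun a b c d => f (sphH a b c d)) a b c d =
      deriv f (sphH a b c d) * (v₂ c d * (sin b * sin d * sin (a - c)) -
        sin d ^ 2 * v₁ c d * (-(cos b * sin d) + sin b * cos d * cos (a - c))) := by
  have h₁ := ((hf (sphH a b c d)).hasDerivAt.comp c (hasDerivAt_sphH_θy a b c d)).deriv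
  have h₂ := ((hf (sphH a b c d)).hasDerivAt.comp d (hasDerivAt_sphH_φy a b c d)).deriv
  simp only [Function.comp_def] at h₁ h₂
  simp only [Vyp, pθy, pφy, h₁, h₂]
  ring

/-- `V_x V_y^⊥ f(h)` vanishes on the diagonal for every twice differentiable `f`. -/
lemma Vx_Vyp_comp_sphH_diagonal {f : ℝ → ℝ} (hf : Differentiable ℝ f)
    (hf' : Differentiable ℝ (deriv f)) (v₁ v₂ : ℝ → ℝ → ℝ) (θ φ : ℝ) :
    Vx v₁ v₂ (Vyp v₁ v₂ (fun a b c d => f (sphH a b c d))) θ φ θ φ = 0 := by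
  have hθ : HasDerivAt (fun t => v₂ θ φ * (sin φ * sin φ * sin (t - θ)) -
      sin φ ^ 2 * v₁ θ φ * (-(cos φ * sin φ) + sin φ * cos φ * cos (t - θ)))
      (v₂ θ φ * sin φ ^ 2) θ := by
    have hid := (hasDerivAt_id θ).sub_const θ
    have h := ((hid.sin.const_mul (sin φ * sin φ)).const_mul (v₂ θ φ)).sub
      (((hid.cos.const_mul (sin φ * cos φ)).const_add (-(cos φ * sin φ))).const_mul
        (sin φ ^ 2 * v₁ θ φ))
    exact h.congr_deriv (by simp only [id, sub_self, sin_zero, cos_zero]; ring)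
  have hφ : HasDerivAt (fun t => v₂ θ φ * (sin t * sin φ * sin (θ - θ)) -
      sin φ ^ 2 * v₁ θ φ * (-(cos t * sin φ) + sin t * cos φ * cos (θ - θ)))
      (-(sin φ ^ 2 * v₁ θ φ)) φ := by
    have hs := hasDerivAt_sin φ
    have h := (((hs.mul_const (sin φ)).mul_const (sin (θ - θ))).const_mul (v₂ θ φ)).sub
      (((((hasDerivAt_cos φ).mul_const (sin φ)).neg).add
        ((hs.mul_const (cos φ)).mul_const (cos (θ - θ)))).const_mul (sin φ ^ 2 * v₁ θ φ))
    refine h.congr_deriv ?_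
    simp only [sub_self, sin_zero, cos_zero]
    linear_combination -(sin φ ^ 2 * v₁ θ φ) * sin_sq_add_cos_sq φ
  have hf'h := (hf' (sphH θ φ θ φ)).hasDerivAt
  have h₁ := ((hf'h.comp (h := fun t => sphH t φ θ φ) θ (hasDerivAt_sphH_θx θ φ θ φ)).mul hθ).deriv
  have h₂ := ((hf'h.comp (h := fun t => sphH θ t θ φ) φ (hasDerivAt_sphH_φx θ φ θ φ)).mul hφ).deriv
  simp only [Function.comp_def, Pi.mul_def] at h₁ h₂
  simp only [Vx, pθx, pφx, Vyp_comp_sphH hf]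
  rw [h₁, h₂, sub_self, sin_zero, cos_zero]
  ring

/-- `V_x V_y^⊥ P_l(h)` vanishes on the diagonal. -/
theorem VxVyperp_on_diagonal
    (v₁ v₂ : ℝ → ℝ → ℝ)
    (hv₁ : ContDiff ℝ (⊤ : ℕ∞) (Function.uncurry v₁)) (hv₂ : ContDiff ℝ (⊤ : ℕ∞) (Function.uncurry v₂))
    (l : ℕ) (θ φ : ℝ) (hφ : φ ∈ Set.Ioo 0 π) :
    Vx v₁ v₂ (Vyp v₁ v₂ (PH l)) θ φ θ φ = 0 := by
  have hP : ContDiff ℝ 2 (legP l) := contDiff_infty.1 (contDiff_legP l) 2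
  exact Vx_Vyp_comp_sphH_diagonal (hP.differentiable (by norm_num))
    (hP.differentiable_deriv_two) v₁ v₂ θ φ
end

section
/- The determinant of the conditional covariance matrix satisfies det Δ_l(θ, φ) = (‖V‖⁶(θ, φ) sin²(φ)/16) l⁶ + O(l⁵), with the remainder bounded uniformly in (θ, φ) by a constant depending only on v₁, v₂ and their first derivatives. Moreover, there is l₀ = l₀(V) such that for all l ≥ l₀ and all (θ, φ) with φ ∈ (0, π): det Δ_l(θ, φ) = 0 if and only if V(θ, φ) = 0 (i.e., v₁(θ, φ) = v₂(θ, φ) = 0). -/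
open Real

/-- `‖V‖²(θ,φ) = sin²(φ) v₁(θ,φ)² + v₂(θ,φ)²`. -/
noncomputable def nV2 (v₁ v₂ : ℝ → ℝ → ℝ) (θ φ : ℝ) : ℝ :=
  (Real.sin φ) ^ 2 * (v₁ θ φ) ^ 2 + (v₂ θ φ) ^ 2

/-- The operators `D₁ = id`, `D₂ = V`, `D₃ = V^⊥`, `D₄ = VV`, acting in the `x`-variables. -/
noncomputable def Dx4 (v₁ v₂ : ℝ → ℝ → ℝ) : Fin 4 → F4 → F4 :=
  ![id, Vx v₁ v₂, Vxp v₁ v₂, fun f => Vx v₁ v₂ (Vx v₁ v₂ f)]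

/-- The operators `D₁ = id`, `D₂ = V`, `D₃ = V^⊥`, `D₄ = VV`, acting in the `y`-variables. -/
noncomputable def Dy4 (v₁ v₂ : ℝ → ℝ → ℝ) : Fin 4 → F4 → F4 :=
  ![id, Vy v₁ v₂, Vyp v₁ v₂, fun f => Vy v₁ v₂ (Vy v₁ v₂ f)]

/-- The full 4×4 covariance matrix `A_l(θ,φ)`, with `(i,j)` entry
`D_i^x D_j^y P_l(h)` evaluated on the diagonal. -/
noncomputable def Amat (v₁ v₂ : ℝ → ℝ → ℝ) (l : ℕ) (θ φ : ℝ) : Matrix (Fin 4) (Fin 4) ℝ :=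
  Matrix.of fun i j => Dx4 v₁ v₂ i (Dy4 v₁ v₂ j (PH l)) θ φ θ φ

/-- Top-left 2×2 block `C₁₁` of `A_l`. -/
noncomputable def C11m (v₁ v₂ : ℝ → ℝ → ℝ) (l : ℕ) (θ φ : ℝ) : Matrix (Fin 2) (Fin 2) ℝ :=
  !![Amat v₁ v₂ l θ φ 0 0, Amat v₁ v₂ l θ φ 0 1;
     Amat v₁ v₂ l θ φ 1 0, Amat v₁ v₂ l θ φ 1 1]

/-- Top-right 2×2 block `C₁₂` of `A_l`. -/
noncomputable def C12m (v₁ v₂ : ℝ → ℝ → ℝ) (l : ℕ) (θ φ : ℝ) : Matrix (Fin 2) (Fin 2) ℝ :=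
  !![Amat v₁ v₂ l θ φ 0 2, Amat v₁ v₂ l θ φ 0 3;
     Amat v₁ v₂ l θ φ 1 2, Amat v₁ v₂ l θ φ 1 3]

/-- Bottom-left 2×2 block `C₂₁` of `A_l`. -/
noncomputable def C21m (v₁ v₂ : ℝ → ℝ → ℝ) (l : ℕ) (θ φ : ℝ) : Matrix (Fin 2) (Fin 2) ℝ :=
  !![Amat v₁ v₂ l θ φ 2 0, Amat v₁ v₂ l θ φ 2 1;
     Amat v₁ v₂ l θ φ 3 0, Amat v₁ v₂ l θ φ 3 1]

/-- Bottom-right 2×2 block `C₂₂` of `A_l`. -/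
noncomputable def C22m (v₁ v₂ : ℝ → ℝ → ℝ) (l : ℕ) (θ φ : ℝ) : Matrix (Fin 2) (Fin 2) ℝ :=
  !![Amat v₁ v₂ l θ φ 2 2, Amat v₁ v₂ l θ φ 2 3;
     Amat v₁ v₂ l θ φ 3 2, Amat v₁ v₂ l θ φ 3 3]

/-- The conditional covariance matrix `Δ_l(θ,φ) = C₂₂ − C₂₁ C₁₁⁻¹ C₁₂`. -/
noncomputable def Dmat (v₁ v₂ : ℝ → ℝ → ℝ) (l : ℕ) (θ φ : ℝ) : Matrix (Fin 2) (Fin 2) ℝ :=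
  C22m v₁ v₂ l θ φ - C21m v₁ v₂ l θ φ * (C11m v₁ v₂ l θ φ)⁻¹ * C12m v₁ v₂ l θ φ

/-- The degree-`l` Legendre polynomial as an element of `ℝ[X]`. -/
noncomputable def legPoly (l : ℕ) : Polynomial ℝ :=
  Polynomial.C (1 / (2 ^ l * (Nat.factorial l : ℝ))) *
    Polynomial.derivative^[l] ((Polynomial.X ^ 2 - 1) ^ l)

lemma legP_eq_eval (l : ℕ) (t : ℝ) : legP l t = (legPoly l).eval t := by
  have h : ∀ (n : ℕ) (p : Polynomial ℝ),
      iteratedDeriv n (fun s => p.eval s) = fun s => (Polynomial.derivative^[n] p).eval s := by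
    intro n
    induction n with
    | zero => intro p; simp
    | succ n ih =>
      intro p
      have hd : deriv (fun s => p.eval s) = fun s => (Polynomial.derivative p).eval s := by
        funext s; exact p.deriv
      rw [iteratedDeriv_succ', hd, ih, Function.iterate_succ_apply]
  have h' := congrFun (h l ((Polynomial.X ^ 2 - 1) ^ l)) t
  simp only [Polynomial.eval_pow, Polynomial.eval_sub, Polynomial.eval_X,
    Polynomial.eval_one] at h'
  rw [legP, legPoly, h', Polynomial.eval_mul, Polynomial.eval_C]

/-- All derivatives of the Legendre polynomial at `1`, from the Taylor expansion of
`(t² − 1)ˡ = (t − 1)ˡ (t + 1)ˡ` there. -/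
lemma eval_one_iterate_derivative_legPoly (l k : ℕ) :
    (Polynomial.derivative^[k] (legPoly l)).eval 1 =
      1 / (2 ^ l * (Nat.factorial l : ℝ)) *
        ((Nat.factorial (k + l) : ℝ) * (2 ^ (l - k) * (l.choose k : ℝ))) := by
  have htaylor : Polynomial.taylor (1 : ℝ) ((Polynomial.X ^ 2 - 1) ^ l) =
      Polynomial.X ^ l * (Polynomial.X + Polynomial.C 2) ^ l := by
    rw [Polynomial.taylor_pow, ← mul_pow]
    congr 1
    simp only [Polynomial.taylor_apply, Polynomial.sub_comp, Polynomial.pow_comp,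
      Polynomial.X_comp, Polynomial.one_comp, map_one]
    rw [show (Polynomial.C (2 : ℝ)) = 2 from rfl]
    ring
  have hcoeff := congrArg (fun p => Polynomial.coeff p (k + l)) htaylor
  simp only [Polynomial.taylor_coeff, Polynomial.coeff_X_pow_mul,
    Polynomial.coeff_X_add_C_pow] at hcoeff
  rw [legPoly, Polynomial.iterate_derivative_C_mul, Polynomial.eval_mul, Polynomial.eval_C,
    ← Function.iterate_add_apply, ← Polynomial.factorial_smul_hasseDeriv]
  simp [hcoeff]

lemma legPoly_eval_one (l : ℕ) : (legPoly l).eval 1 = 1 := by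
  have h := eval_one_iterate_derivative_legPoly l 0
  have := Nat.factorial_pos l
  simp only [Function.iterate_zero, id_eq, zero_add, Nat.sub_zero, Nat.choose_zero_right,
    Nat.cast_one, mul_one] at h
  rw [h]
  field_simp

lemma derivative_legPoly_eval_one (l : ℕ) :
    (Polynomial.derivative (legPoly l)).eval 1 = (l : ℝ) * (l + 1) / 2 := by
  have h := eval_one_iterate_derivative_legPoly l 1
  have := Nat.factorial_pos l
  rw [Function.iterate_one] at h
  rw [h]
  rcases l with _ | l
  · simp
  · rw [add_comm 1, Nat.factorial_succ (l + 1), Nat.choose_one_right, Nat.add_sub_cancel]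
    push_cast
    field_simp
    ring

lemma derivative_derivative_legPoly_eval_one (l : ℕ) :
    (Polynomial.derivative (Polynomial.derivative (legPoly l))).eval 1 =
      ((l : ℝ) - 1) * l * (l + 1) * (l + 2) / 8 := by
  have h := eval_one_iterate_derivative_legPoly l 2
  have := Nat.factorial_pos l
  rw [Function.iterate_succ_apply, Function.iterate_one] at h
  rw [h]
  rcases l with _ | _ | l
  · simp
  · simp
  · rw [add_comm 2, Nat.factorial_succ (l + 1 + 1 + 1), Nat.factorial_succ (l + 1 + 1),
      Nat.cast_choose_two, show l + 1 + 1 - 2 = l by omega]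
    push_cast
    field_simp
    ring

/-- `g` is the derivative of `f` along the vector field `w₁ ∂₁ + w₂ ∂₂`, the partial derivatives
of `f` being assumed to exist. -/
def HasFieldDeriv (w₁ w₂ f g : ℝ → ℝ → ℝ) : Prop :=
  ∀ a b, ∃ p q, HasDerivAt (fun t => f t b) p a ∧ HasDerivAt (fun t => f a t) q b ∧
    g a b = w₁ a b * p + w₂ a b * q

namespace HasFieldDeriv

variable {w₁ w₂ f g f' g' : ℝ → ℝ → ℝ}

lemma add (hf : HasFieldDeriv w₁ w₂ f f') (hg : HasFieldDeriv w₁ w₂ g g') :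
    HasFieldDeriv w₁ w₂ (fun a b => f a b + g a b) (fun a b => f' a b + g' a b) := by
  intro a b
  obtain ⟨p, q, hp, hq, h⟩ := hf a b
  obtain ⟨p', q', hp', hq', h'⟩ := hg a b
  exact ⟨p + p', q + q', hp.add hp', hq.add hq', by simp only [h, h']; ring⟩

lemma mul (hf : HasFieldDeriv w₁ w₂ f f') (hg : HasFieldDeriv w₁ w₂ g g') :
    HasFieldDeriv w₁ w₂ (fun a b => f a b * g a b)
      (fun a b => f' a b * g a b + f a b * g' a b) := by
  intro a b
  obtain ⟨p, q, hp, hq, h⟩ := hf a b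
  obtain ⟨p', q', hp', hq', h'⟩ := hg a b
  exact ⟨_, _, hp.mul hp', hq.mul hq', by simp only [h, h']; ring⟩

lemma sum {ι : Type*} {s : Finset ι} {f f' : ι → ℝ → ℝ → ℝ}
    (hf : ∀ i, HasFieldDeriv w₁ w₂ (f i) (f' i)) :
    HasFieldDeriv w₁ w₂ (fun a b => ∑ i ∈ s, f i a b) (fun a b => ∑ i ∈ s, f' i a b) := by
  intro a b
  choose p q hp hq h using fun i => hf i a b
  refine ⟨_, _, HasDerivAt.fun_sum fun i _ => hp i, HasDerivAt.fun_sum fun i _ => hq i, ?_⟩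
  simp only [h, Finset.mul_sum, Finset.sum_add_distrib]

lemma const_mul (c : ℝ) (hf : HasFieldDeriv w₁ w₂ f f') :
    HasFieldDeriv w₁ w₂ (fun a b => c * f a b) (fun a b => c * f' a b) := by
  intro a b
  obtain ⟨p, q, hp, hq, h⟩ := hf a b
  exact ⟨_, _, hp.const_mul c, hq.const_mul c, by simp only [h]; ring⟩

lemma mul_const (c : ℝ) (hf : HasFieldDeriv w₁ w₂ f f') :
    HasFieldDeriv w₁ w₂ (fun a b => f a b * c) (fun a b => f' a b * c) := by
  intro a b
  obtain ⟨p, q, hp, hq, h⟩ := hf a b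
  exact ⟨_, _, hp.mul_const c, hq.mul_const c, by simp only [h]; ring⟩

lemma eval (P : Polynomial ℝ) (hf : HasFieldDeriv w₁ w₂ f f') :
    HasFieldDeriv w₁ w₂ (fun a b => P.eval (f a b))
      (fun a b => (Polynomial.derivative P).eval (f a b) * f' a b) := by
  intro a b
  obtain ⟨p, q, hp, hq, h⟩ := hf a b
  exact ⟨_, _, (P.hasDerivAt _).comp a hp, (P.hasDerivAt _).comp b hq, by simp only [h]; ring⟩

end HasFieldDeriv

lemma Vxp_eq_Vx (v₁ v₂ : ℝ → ℝ → ℝ) (f : F4) :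
    Vxp v₁ v₂ f = Vx v₂ (fun a b => -(Real.sin b ^ 2 * v₁ a b)) f := by
  funext a b c d
  simp only [Vxp, Vx]
  ring

lemma Vyp_eq_Vy (v₁ v₂ : ℝ → ℝ → ℝ) (f : F4) :
    Vyp v₁ v₂ f = Vy v₂ (fun a b => -(Real.sin b ^ 2 * v₁ a b)) f := by
  funext a b c d
  simp only [Vyp, Vy]
  ring

/-- The pairing `⟨U(θ_x, φ_x), W(θ_y, φ_y)⟩` of two `ℝ³`-valued functions. -/
noncomputable def pairing (U W : Fin 3 → ℝ → ℝ → ℝ) : F4 :=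
  fun a b c d => ∑ k, U k a b * W k c d

/-- The point of the unit sphere with spherical coordinates `(θ, φ)`. -/
noncomputable def spherePt : Fin 3 → ℝ → ℝ → ℝ :=
  ![fun a b => Real.sin b * Real.cos a, fun a b => Real.sin b * Real.sin a,
    fun _ b => Real.cos b]

/-- The unit tangent vector in the direction of `∂/∂θ`. -/
noncomputable def unitθ : Fin 3 → ℝ → ℝ → ℝ :=
  ![fun a _ => -Real.sin a, fun a _ => Real.cos a, fun _ _ => 0]

/-- The unit tangent vector in the direction of `∂/∂φ`. -/
noncomputable def unitφ : Fin 3 → ℝ → ℝ → ℝ :=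
  ![fun a b => Real.cos b * Real.cos a, fun a b => Real.cos b * Real.sin a,
    fun _ b => -Real.sin b]

/-- The `ℝ³`-valued function with coordinates `x, t, p` in the frame
`(spherePt, unitθ, unitφ)`. -/
noncomputable def frameComb (x t p : ℝ → ℝ → ℝ) : Fin 3 → ℝ → ℝ → ℝ :=
  fun k a b => x a b * spherePt k a b + t a b * unitθ k a b + p a b * unitφ k a b

lemma pairing_frameComb (x t p x' t' p' : ℝ → ℝ → ℝ) (a b : ℝ) :
    pairing (frameComb x t p) (frameComb x' t' p') a b a b =
      x a b * x' a b + t a b * t' a b + p a b * p' a b := by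
  have h₁ := Real.sin_sq_add_cos_sq a
  have h₂ := Real.sin_sq_add_cos_sq b
  simp only [pairing, frameComb, spherePt, unitθ, unitφ, Fin.sum_univ_three, Matrix.cons_val]
  generalize Real.sin a = sa at *
  generalize Real.cos a = ca at *
  generalize Real.sin b = sb at *
  generalize Real.cos b = cb at *
  have e₁ : sa ^ 2 = 1 - ca ^ 2 := by linarith
  have e₂ : sb ^ 2 = 1 - cb ^ 2 := by linarith
  ring_nf
  simp only [e₁, e₂]
  ring

lemma spherePt_eq_frameComb :
    spherePt = frameComb (fun _ _ => 1) (fun _ _ => 0) (fun _ _ => 0) := by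
  funext k a b
  simp [frameComb]

lemma sphH_eq_pairing : sphH = pairing spherePt spherePt := by
  funext a b c d
  simp only [sphH, pairing, spherePt, Fin.sum_univ_three, Matrix.cons_val, Real.cos_sub]
  ring

/-- Covariant differentiation in the moving frame of the sphere. -/
lemma hasFieldDeriv_frameComb {w₁ w₂ x t p x' t' p' : ℝ → ℝ → ℝ}
    (hx : HasFieldDeriv w₁ w₂ x x') (ht : HasFieldDeriv w₁ w₂ t t')
    (hp : HasFieldDeriv w₁ w₂ p p') (k : Fin 3) :
    HasFieldDeriv w₁ w₂ (frameComb x t p k)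
      (frameComb
        (fun a b => x' a b - w₁ a b * Real.sin b * t a b - w₂ a b * p a b)
        (fun a b => t' a b + w₁ a b * (Real.sin b * x a b + Real.cos b * p a b))
        (fun a b => p' a b + w₂ a b * x a b - w₁ a b * Real.cos b * t a b) k) := by
  have hX : HasFieldDeriv w₁ w₂ (spherePt k) (fun a b =>
      w₁ a b * Real.sin b * unitθ k a b + w₂ a b * unitφ k a b) := by
    intro a b
    fin_cases k
    · exact ⟨_, _, (Real.hasDerivAt_cos a).const_mul _, (Real.hasDerivAt_sin b).mul_const _,
        by simp [unitθ, unitφ]; ring⟩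
    · exact ⟨_, _, (Real.hasDerivAt_sin a).const_mul _, (Real.hasDerivAt_sin b).mul_const _,
        by simp [unitθ, unitφ]; ring⟩
    · exact ⟨_, _, hasDerivAt_const _ _, Real.hasDerivAt_cos b, by simp [unitθ, unitφ]⟩
  have hT : HasFieldDeriv w₁ w₂ (unitθ k) (fun a b =>
      -(w₁ a b * Real.sin b) * spherePt k a b - w₁ a b * Real.cos b * unitφ k a b) := by
    intro a b
    have h₂ := Real.sin_sq_add_cos_sq b
    fin_cases k
    · exact ⟨_, _, (Real.hasDerivAt_sin a).neg, hasDerivAt_const _ _, by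
        simp [spherePt, unitφ]; linear_combination (-w₁ a b * Real.cos a) * h₂⟩
    · exact ⟨_, _, Real.hasDerivAt_cos a, hasDerivAt_const _ _, by
        simp [spherePt, unitφ]; linear_combination (-w₁ a b * Real.sin a) * h₂⟩
    · exact ⟨_, _, hasDerivAt_const _ _, hasDerivAt_const _ _, by
        simp [spherePt, unitφ]; ring⟩
  have hP : HasFieldDeriv w₁ w₂ (unitφ k) (fun a b =>
      w₁ a b * Real.cos b * unitθ k a b - w₂ a b * spherePt k a b) := by
    intro a b
    fin_cases k
    · exact ⟨_, _, (Real.hasDerivAt_cos a).const_mul _, (Real.hasDerivAt_cos b).mul_const _,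
        by simp [unitθ, spherePt]; ring⟩
    · exact ⟨_, _, (Real.hasDerivAt_sin a).const_mul _, (Real.hasDerivAt_cos b).mul_const _,
        by simp [unitθ, spherePt]; ring⟩
    · exact ⟨_, _, hasDerivAt_const _ _, (Real.hasDerivAt_sin b).neg,
        by simp [unitθ, spherePt]⟩
  convert ((hx.mul hX).add (ht.mul hT)).add (hp.mul hP) using 1 <;>
    (funext a b; simp only [frameComb])
  ring

/-- `g = (w₁ ∂/∂θ_x + w₂ ∂/∂φ_x) f`, the partial derivatives of `f` being assumed to exist. -/
def HasVx (w₁ w₂ : ℝ → ℝ → ℝ) (f g : F4) : Prop :=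
  ∀ c d, HasFieldDeriv w₁ w₂ (fun a b => f a b c d) (fun a b => g a b c d)

/-- `g = (w₁ ∂/∂θ_y + w₂ ∂/∂φ_y) f`, the partial derivatives of `f` being assumed to exist. -/
def HasVy (w₁ w₂ : ℝ → ℝ → ℝ) (f g : F4) : Prop :=
  ∀ a b, HasFieldDeriv w₁ w₂ (fun c d => f a b c d) (fun c d => g a b c d)

/-- The function `P(h)` of the four variables, for a polynomial `P`. -/
noncomputable def evalH (P : Polynomial ℝ) : F4 :=
  fun a b c d => P.eval (pairing spherePt spherePt a b c d)

lemma PH_eq_evalH (l : ℕ) : PH l = evalH (legPoly l) := by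
  funext a b c d
  simp only [PH, evalH, legP_eq_eval, sphH_eq_pairing]

namespace HasVx

variable {w₁ w₂ : ℝ → ℝ → ℝ} {f f' g g' : F4} {U U' : Fin 3 → ℝ → ℝ → ℝ}

lemma eq (h : HasVx w₁ w₂ f g) : Vx w₁ w₂ f = g := by
  funext a b c d
  obtain ⟨p, q, hp, hq, h⟩ := h c d a b
  simp only [Vx, pθx, pφx, hp.deriv, hq.deriv, h]

lemma add (hf : HasVx w₁ w₂ f f') (hg : HasVx w₁ w₂ g g') :
    HasVx w₁ w₂ (f + g) (f' + g') :=
  fun c d => (hf c d).add (hg c d)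

lemma mul (hf : HasVx w₁ w₂ f f') (hg : HasVx w₁ w₂ g g') :
    HasVx w₁ w₂ (f * g) (f' * g + f * g') :=
  fun c d => (hf c d).mul (hg c d)

lemma pairing (h : ∀ k, HasFieldDeriv w₁ w₂ (U k) (U' k)) (W : Fin 3 → ℝ → ℝ → ℝ) :
    HasVx w₁ w₂ (pairing U W) (_root_.pairing U' W) :=
  fun _ _ => .sum fun k => (h k).mul_const _

lemma evalH (h : ∀ k, HasFieldDeriv w₁ w₂ (spherePt k) (U k)) (P : Polynomial ℝ) :
    HasVx w₁ w₂ (evalH P) (_root_.evalH (Polynomial.derivative P) * _root_.pairing U spherePt) :=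
  fun c d => (pairing h spherePt c d).eval P

end HasVx

namespace HasVy

variable {w₁ w₂ : ℝ → ℝ → ℝ} {f f' g g' : F4} {U U' : Fin 3 → ℝ → ℝ → ℝ}

lemma eq (h : HasVy w₁ w₂ f g) : Vy w₁ w₂ f = g := by
  funext a b c d
  obtain ⟨p, q, hp, hq, h⟩ := h a b c d
  simp only [Vy, pθy, pφy, hp.deriv, hq.deriv, h]

lemma mul (hf : HasVy w₁ w₂ f f') (hg : HasVy w₁ w₂ g g') :
    HasVy w₁ w₂ (f * g) (f' * g + f * g') :=
  fun a b => (hf a b).mul (hg a b)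

lemma pairing (h : ∀ k, HasFieldDeriv w₁ w₂ (U k) (U' k)) (W : Fin 3 → ℝ → ℝ → ℝ) :
    HasVy w₁ w₂ (pairing W U) (_root_.pairing W U') :=
  fun _ _ => .sum fun k => (h k).const_mul _

lemma evalH (h : ∀ k, HasFieldDeriv w₁ w₂ (spherePt k) (U k)) (P : Polynomial ℝ) :
    HasVy w₁ w₂ (evalH P) (_root_.evalH (Polynomial.derivative P) * _root_.pairing spherePt U) :=
  fun a b => (pairing h spherePt a b).eval P

end HasVy

open Polynomial (derivative) in
/-- The matrix `A_l` in terms of `E = V X`, `F = V^⊥ X`, `G = V V X`, where `X` is the position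
vector on the sphere: all entries reduce to Euclidean inner products and to the
first two derivatives of `P_l` at `1`. -/
lemma Amat_eq_of_pairings {v₁ v₂ : ℝ → ℝ → ℝ} {E F G : Fin 3 → ℝ → ℝ → ℝ}
    (hE : ∀ k, HasFieldDeriv v₁ v₂ (spherePt k) (E k))
    (hG : ∀ k, HasFieldDeriv v₁ v₂ (E k) (G k))
    (hF : ∀ k, HasFieldDeriv v₂ (fun a b => -(Real.sin b ^ 2 * v₁ a b)) (spherePt k) (F k))
    (l : ℕ) {θ φ n m e f g : ℝ}
    (hXX : pairing spherePt spherePt θ φ θ φ = 1)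
    (hXE : pairing spherePt E θ φ θ φ = 0)
    (hXF : pairing spherePt F θ φ θ φ = 0)
    (hXG : pairing spherePt G θ φ θ φ = -n)
    (hEE : pairing E E θ φ θ φ = n)
    (hEF : pairing E F θ φ θ φ = 0)
    (hEG : pairing E G θ φ θ φ = e)
    (hFF : pairing F F θ φ θ φ = m)
    (hFG : pairing F G θ φ θ φ = f)
    (hGG : pairing G G θ φ θ φ = g) :
    let α := (l : ℝ) * (l + 1) / 2
    let β := ((l : ℝ) - 1) * l * (l + 1) * (l + 2) / 8
    Amat v₁ v₂ l θ φ =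
      !![1, 0, 0, -(α * n);
         0, α * n, 0, α * e;
         0, 0, α * m, α * f;
         -(α * n), α * e, α * f, 3 * β * n ^ 2 + α * g] := by
  intro α β
  have hsymm : ∀ U W, pairing U W θ φ θ φ = pairing W U θ φ θ φ := fun U W =>
    Finset.sum_congr rfl fun k _ => mul_comm _ _
  have hEX := (hsymm E spherePt).trans hXE
  have hFX := (hsymm F spherePt).trans hXF
  have hGX := (hsymm G spherePt).trans hXG
  have hFE := (hsymm F E).trans hEF
  have hGE := (hsymm G E).trans hEG
  have hGF := (hsymm G F).trans hFG
  have h₀ : evalH (legPoly l) θ φ θ φ = 1 := by rw [evalH, hXX, legPoly_eval_one]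
  have h₁ : evalH (derivative (legPoly l)) θ φ θ φ = α := by
    rw [evalH, hXX, derivative_legPoly_eval_one]
  have h₂ : evalH (derivative (derivative (legPoly l))) θ φ θ φ = β := by
    rw [evalH, hXX, derivative_derivative_legPoly_eval_one]
  have hy₁ := HasVy.evalH hE (legPoly l)
  have hy₂ := HasVy.evalH hF (legPoly l)
  have hy₃ := (HasVy.evalH hE (derivative (legPoly l))).mul (HasVy.pairing hG spherePt)
  have hx₀ {w₁ w₂} {U : Fin 3 → ℝ → ℝ → ℝ} (hU : ∀ k, HasFieldDeriv w₁ w₂ (spherePt k) (U k)) :=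
    HasVx.evalH hU (legPoly l)
  have hx₁ {w₁ w₂} {U : Fin 3 → ℝ → ℝ → ℝ} (hU : ∀ k, HasFieldDeriv w₁ w₂ (spherePt k) (U k))
      (W) := (HasVx.evalH hU (derivative (legPoly l))).mul (HasVx.pairing hU W)
  have hx₃ {w₁ w₂} {U : Fin 3 → ℝ → ℝ → ℝ} (hU : ∀ k, HasFieldDeriv w₁ w₂ (spherePt k) (U k)) :=
    (((HasVx.evalH hU (derivative (derivative (legPoly l)))).mul (HasVx.pairing hU E)).mul
      (HasVx.pairing hU E)).add
        ((HasVx.evalH hU (derivative (legPoly l))).mul (HasVx.pairing hU G))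
  have hS := HasVx.pairing hE
  have hT := HasVx.pairing hG
  have hD₁ := HasVx.evalH hE (derivative (legPoly l))
  have hD₂ := HasVx.evalH hE (derivative (derivative (legPoly l)))
  have hD₃ := HasVx.evalH hE (derivative (derivative (derivative (legPoly l))))
  have hxx₀ := hD₁.mul (hT spherePt)
  have hxx₁ (W) := ((hD₂.mul (hT spherePt)).mul (hS W)).add (hD₁.mul (hT W))
  have hxx₃ :=
    ((((hD₃.mul (hT spherePt)).mul (hS E)).add (hD₂.mul (hT E))).mul (hS E)).add
      ((hD₂.mul (hS E)).mul (hT E)) |>.add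
        (((hD₂.mul (hT spherePt)).mul (hS G)).add (hD₁.mul (hT G)))
  have hVyp := Vyp_eq_Vy v₁ v₂
  have hVxp := Vxp_eq_Vx v₁ v₂
  ext i j
  fin_cases i <;> fin_cases j <;>
    simp only [Amat, Dx4, Dy4, Matrix.of_apply, Matrix.cons_val, Fin.zero_eta, Fin.mk_one,
      Fin.reduceFinMk, id_eq, PH_eq_evalH, hVyp, hVxp, hy₁.eq, hy₂.eq, hy₃.eq, (hx₀ hE).eq,
      (hx₀ hF).eq, (hx₁ hE _).eq, (hx₁ hF _).eq, (hx₃ hE).eq, (hx₃ hF).eq, hxx₀.eq,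
      (hxx₁ _).eq, hxx₃.eq, Pi.add_apply, Pi.mul_apply, h₀, h₁, h₂, hXE, hXF, hXG, hEE,
      hEF, hEG, hFF, hFG, hGG, hEX, hFX, hGX, hFE, hGE, hGF] <;>
    ring

lemma exists_hasFieldDeriv {v : ℝ → ℝ → ℝ} (hv : Differentiable ℝ (Function.uncurry v))
    (w₁ w₂ : ℝ → ℝ → ℝ) : ∃ v', HasFieldDeriv w₁ w₂ v v' := by
  refine ⟨fun a b => w₁ a b * deriv (fun t => v t b) a + w₂ a b * deriv (fun t => v a t) b,
    fun a b => ⟨_, _, DifferentiableAt.hasDerivAt ?_, DifferentiableAt.hasDerivAt ?_, rfl⟩⟩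
  · exact (hv.comp (differentiable_id.prodMk (differentiable_const b)) : _) a
  · exact (hv.comp ((differentiable_const a).prodMk differentiable_id) : _) b

lemma hasFieldDeriv_const (w₁ w₂ : ℝ → ℝ → ℝ) (c : ℝ) :
    HasFieldDeriv w₁ w₂ (fun _ _ => c) (fun _ _ => 0) :=
  fun _ _ => ⟨0, 0, hasDerivAt_const _ _, hasDerivAt_const _ _, by ring⟩

lemma hasFieldDeriv_sin_snd (w₁ w₂ : ℝ → ℝ → ℝ) :
    HasFieldDeriv w₁ w₂ (fun _ b => Real.sin b) (fun a b => w₂ a b * Real.cos b) :=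
  fun _ b => ⟨0, _, hasDerivAt_const _ _, Real.hasDerivAt_sin b, by ring⟩

lemma hasFieldDeriv_spherePt (w₁ w₂ : ℝ → ℝ → ℝ) (k : Fin 3) :
    HasFieldDeriv w₁ w₂ (spherePt k)
      (frameComb (fun _ _ => 0) (fun a b => Real.sin b * w₁ a b) w₂ k) := by
  have h := hasFieldDeriv_frameComb (hasFieldDeriv_const w₁ w₂ 1) (hasFieldDeriv_const w₁ w₂ 0)
    (hasFieldDeriv_const w₁ w₂ 0) k
  rw [← spherePt_eq_frameComb] at h
  convert h using 2
  all_goals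
    funext a b
    ring

lemma det_schur_complement (α s x y t p : ℝ) :
    let n := s ^ 2 * x ^ 2 + y ^ 2
    let e := s * x * t + y * p
    let f := s * y * t - s ^ 2 * x * p
    let r := (α * n)⁻¹
    Matrix.det !![α * (s ^ 2 * n), α * f;
        α * f, 3 * (α * (α - 1) / 2) * n ^ 2 + α * (n ^ 2 + t ^ 2 + p ^ 2) -
          (α * n * (r * (α * n)) * (α * n) + α * e * r * (α * e))] =
      α ^ 2 * (α - 1) / 2 * (n ^ 3 * s ^ 2) := by
  intro n e f r
  rw [Matrix.det_fin_two_of]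
  rcases eq_or_ne (α * n) 0 with h | h
  · have hf : α * f = 0 := by
      rcases mul_eq_zero.mp h with h | h
      · rw [h, zero_mul]
      · have hsx : s * x = 0 := by
          apply pow_eq_zero_iff two_ne_zero |>.mp
          have : (s * x) ^ 2 + y ^ 2 = 0 := by rw [mul_pow]; exact h
          nlinarith [sq_nonneg (s * x), sq_nonneg y]
        have hy : y = 0 := by
          apply pow_eq_zero_iff two_ne_zero |>.mp
          have : (s * x) ^ 2 + y ^ 2 = 0 := by rw [mul_pow]; exact h
          nlinarith [sq_nonneg (s * x), sq_nonneg y]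
        simp only [f]
        linear_combination α * s * t * hy - α * s * p * hsx
    rw [hf]
    linear_combination
      (s ^ 2 * (3 * (α * (α - 1) / 2) * n ^ 2 + α * (n ^ 2 + t ^ 2 + p ^ 2) -
        (α * n * (r * (α * n)) * (α * n) + α * e * r * (α * e))) -
        α * (α - 1) / 2 * n ^ 2 * s ^ 2) * h
  · have hr : α * n * r = 1 := mul_inv_cancel₀ h
    have hgram : n * s ^ 2 * (t ^ 2 + p ^ 2) = s ^ 2 * e ^ 2 + f ^ 2 := by
      simp only [n, e, f]; ring
    linear_combination (-(α ^ 3 * s ^ 2 * n ^ 3) - α ^ 2 * s ^ 2 * e ^ 2) * hr + α ^ 2 * hgram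

lemma det_Dmat {v₁ v₂ : ℝ → ℝ → ℝ} (hv₁ : Differentiable ℝ (Function.uncurry v₁))
    (hv₂ : Differentiable ℝ (Function.uncurry v₂)) (l : ℕ) (θ φ : ℝ) :
    (Dmat v₁ v₂ l θ φ).det =
      (l : ℝ) ^ 2 * (l + 1) ^ 2 * ((l - 1) * (l + 2)) / 16 *
        (nV2 v₁ v₂ θ φ ^ 3 * Real.sin φ ^ 2) := by
  obtain ⟨v₁', hv₁'⟩ := exists_hasFieldDeriv hv₁ v₁ v₂
  obtain ⟨v₂', hv₂'⟩ := exists_hasFieldDeriv hv₂ v₁ v₂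
  have hG := hasFieldDeriv_frameComb (hasFieldDeriv_const v₁ v₂ 0)
    ((hasFieldDeriv_sin_snd v₁ v₂).mul hv₁') hv₂'
  have hA := Amat_eq_of_pairings (hasFieldDeriv_spherePt v₁ v₂) hG
    (hasFieldDeriv_spherePt v₂ (fun a b => -(Real.sin b ^ 2 * v₁ a b))) l (θ := θ) (φ := φ)
    (n := nV2 v₁ v₂ θ φ) (m := Real.sin φ ^ 2 * nV2 v₁ v₂ θ φ)
    (by rw [spherePt_eq_frameComb, pairing_frameComb]; ring)
    (by rw [spherePt_eq_frameComb, pairing_frameComb]; ring)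
    (by rw [spherePt_eq_frameComb, pairing_frameComb]; ring)
    (by rw [spherePt_eq_frameComb, pairing_frameComb, nV2]; ring)
    (by rw [pairing_frameComb, nV2]; ring)
    (by rw [pairing_frameComb]; ring)
    (pairing_frameComb ..)
    (by rw [pairing_frameComb, nV2]; ring)
    (pairing_frameComb ..)
    (pairing_frameComb ..)
  dsimp only at hA
  simp only [Dmat, C11m, C12m, C21m, C22m, hA, nV2, Matrix.of_apply, Matrix.cons_val,
    Matrix.inv_def, Matrix.adjugate_fin_two_of, Matrix.det_fin_two_of, Ring.inverse_eq_inv']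
  convert det_schur_complement ((l : ℝ) * (l + 1) / 2) (Real.sin φ) (v₁ θ φ) (v₂ θ φ)
    (2 * v₂ θ φ * Real.cos φ * v₁ θ φ + Real.sin φ * v₁' θ φ)
    (v₂' θ φ - v₁ θ φ ^ 2 * Real.cos φ * Real.sin φ) using 1
  · congr 1
    ext i j
    fin_cases i <;> fin_cases j <;>
      simp only [Matrix.sub_apply, Matrix.mul_apply, Matrix.smul_apply, Fin.sum_univ_two,
        Matrix.of_apply, Matrix.cons_val, smul_eq_mul, Fin.zero_eta, Fin.mk_one] <;>
      ring
  · ring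
lemma exists_bound_of_periodic {v : ℝ → ℝ → ℝ} (hv : Continuous (Function.uncurry v))
    (hper : ∀ θ φ, v (θ + 2 * π) φ = v θ φ) (r s : ℝ) :
    ∃ M, ∀ θ φ, φ ∈ Set.Icc r s → |v θ φ| ≤ M := by
  obtain ⟨M, hM⟩ := (isCompact_Icc.prod isCompact_Icc :
    IsCompact (Set.Icc 0 (2 * π) ×ˢ Set.Icc r s)).exists_bound_of_continuousOn hv.continuousOn
  refine ⟨M, fun θ φ hφ => ?_⟩
  have hp : Function.Periodic v (2 * π) := fun θ => funext (hper θ)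
  obtain ⟨θ', hθ', h⟩ := hp.exists_mem_Ico₀ Real.two_pi_pos θ
  rw [h]
  exact hM (θ', φ) ⟨Set.Ico_subset_Icc_self hθ', hφ⟩

lemma abs_leading_coeff_sub_le (l : ℕ) :
    |(l : ℝ) ^ 2 * (l + 1) ^ 2 * ((l - 1) * (l + 2)) - (l : ℝ) ^ 6| ≤ 9 * (l : ℝ) ^ 5 := by
  rcases Nat.eq_zero_or_pos l with rfl | hl
  · simp
  have h1 : (1 : ℝ) ≤ l := by exact_mod_cast hl
  generalize (l : ℝ) = L at h1
  have h2 : L ^ 2 ≤ L ^ 5 := pow_le_pow_right₀ h1 (by norm_num)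
  have h3 : L ^ 3 ≤ L ^ 5 := pow_le_pow_right₀ h1 (by norm_num)
  have h4 : L ^ 4 ≤ L ^ 5 := pow_le_pow_right₀ h1 (by norm_num)
  have p2 : 0 ≤ L ^ 2 := by positivity
  have p3 : 0 ≤ L ^ 3 := by positivity
  have p4 : 0 ≤ L ^ 4 := by positivity
  have e : L ^ 2 * (L + 1) ^ 2 * ((L - 1) * (L + 2)) - L ^ 6 =
      3 * L ^ 5 + L ^ 4 - 3 * L ^ 3 - 2 * L ^ 2 := by ring
  rw [e, abs_le]
  constructor <;> linarith

/-- the determinant of the conditional covariance matrix satisfies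
`det Δ_l = (‖V‖⁶ sin²φ/16) l⁶ + O(l⁵)` uniformly, and for all large `l` it vanishes
exactly at the zeros of `V`. -/
theorem det_conditional_covariance
    (v₁ v₂ : ℝ → ℝ → ℝ)
    (hv₁ : ContDiff ℝ (⊤ : ℕ∞) (Function.uncurry v₁)) (hv₂ : ContDiff ℝ (⊤ : ℕ∞) (Function.uncurry v₂))
    (hper₁ : ∀ θ φ : ℝ, v₁ (θ + 2 * π) φ = v₁ θ φ)
    (hper₂ : ∀ θ φ : ℝ, v₂ (θ + 2 * π) φ = v₂ θ φ) :
    (∃ C : ℝ, ∀ (l : ℕ) (θ φ : ℝ), φ ∈ Set.Ioo 0 π →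
      |(Dmat v₁ v₂ l θ φ).det -
          (nV2 v₁ v₂ θ φ) ^ 3 * (Real.sin φ) ^ 2 / 16 * (l : ℝ) ^ 6| ≤
        C * (l : ℝ) ^ 5) ∧
    ∃ l₀ : ℕ, ∀ l : ℕ, l₀ ≤ l → ∀ θ φ : ℝ, φ ∈ Set.Ioo 0 π →
      ((Dmat v₁ v₂ l θ φ).det = 0 ↔ v₁ θ φ = 0 ∧ v₂ θ φ = 0) := by
  have hd₁ := hv₁.differentiable (by simp)
  have hd₂ := hv₂.differentiable (by simp)
  refine ⟨?_, 2, fun l hl θ φ hφ => ?_⟩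
  · have hcont : Continuous (Function.uncurry fun θ φ => nV2 v₁ v₂ θ φ ^ 3 * Real.sin φ ^ 2) := by
      have h₁ := hv₁.continuous
      have h₂ := hv₂.continuous
      simp only [nV2, Function.uncurry_def] at *
      fun_prop
    obtain ⟨M, hM⟩ := exists_bound_of_periodic hcont
      (fun θ φ => by simp only [nV2, hper₁, hper₂]) 0 π
    refine ⟨9 / 16 * M, fun l θ φ hφ => ?_⟩
    have hMφ := hM θ φ (Set.Ioo_subset_Icc_self hφ)
    rw [det_Dmat hd₁ hd₂]
    calc _ = 1 / 16 * |(l : ℝ) ^ 2 * (l + 1) ^ 2 * ((l - 1) * (l + 2)) - (l : ℝ) ^ 6| *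
          |nV2 v₁ v₂ θ φ ^ 3 * Real.sin φ ^ 2| := by
          rw [mul_assoc (1 / 16 : ℝ), ← abs_mul, ← abs_of_pos (show (0 : ℝ) < 1 / 16 by norm_num),
            ← abs_mul]
          congr 1
          ring
      _ ≤ 1 / 16 * (9 * (l : ℝ) ^ 5) * M := by
          gcongr
          exact abs_leading_coeff_sub_le l
      _ = 9 / 16 * M * (l : ℝ) ^ 5 := by ring
  · have hs : Real.sin φ ≠ 0 := (Real.sin_pos_of_mem_Ioo hφ).ne'
    have hl' : (2 : ℝ) ≤ l := by exact_mod_cast hl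
    have hcoeff : (l : ℝ) ^ 2 * (l + 1) ^ 2 * ((l - 1) * (l + 2)) / 16 ≠ 0 := by
      have : (0 : ℝ) < l - 1 := by linarith
      positivity
    rw [det_Dmat hd₁ hd₂, mul_eq_zero_iff_left hcoeff,
      mul_eq_zero_iff_right (pow_ne_zero 2 hs), pow_eq_zero_iff three_ne_zero, nV2,
      add_eq_zero_iff_of_nonneg (by positivity) (by positivity)]
    simp [hs]
end
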